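/- arXiv:2404.00099 — 6 statements merged into one kernel-verified Lean document; each statement's English description precedes it below -/
import Mathlib

section
/- Let S be a measurable space, P a probability measure on S, v : S → ℝ a bounded measurable function, Λ ∈ [1,∞), and τ := 1/(Λ+1). Then the infimum of ∫ v dU over all U in the perturbation set U_Λ(P) equals Λ⁻¹ ∫ v dP + (1 − Λ⁻¹) · CVaR⁻_τ(v; P). -/
open MeasureTheory

/-- Lower conditional value-at-risk at level `τ`:
`CVaR⁻_τ(v;P) = sup_{b ∈ ℝ} (b + τ⁻¹ ∫ min(v x − b, 0) dP)`. -/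
noncomputable def cvarLower {S : Type*} [MeasurableSpace S] (τ : ℝ) (v : S → ℝ)
    (P : Measure S) : ℝ :=
  ⨆ b : ℝ, b + τ⁻¹ * ∫ x, min (v x - b) 0 ∂P

/-- The perturbation set `U_Λ(P)`: probability measures `U ≪ P` with
`Λ⁻¹ ≤ dU/dP ≤ Λ` `P`-almost everywhere. -/
def perturbSet {S : Type*} [MeasurableSpace S] (Λ : ℝ) (P : Measure S) : Set (Measure S) :=
  {U | IsProbabilityMeasure U ∧ U ≪ P ∧
    ∀ᵐ x ∂P, ENNReal.ofReal Λ⁻¹ ≤ U.rnDeriv P x ∧ U.rnDeriv P x ≤ ENNReal.ofReal Λ}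

/-- Every probability measure on `ℝ` has a quantile at each level `τ ∈ (0, 1)`. -/
lemma exists_quantile (μ : Measure ℝ) [IsProbabilityMeasure μ] {τ : ℝ} (h0 : 0 < τ)
    (h1 : τ < 1) : ∃ b : ℝ, μ.real (Set.Iio b) ≤ τ ∧ τ ≤ μ.real (Set.Iic b) := by
  set A : Set ℝ := {t | τ ≤ ProbabilityTheory.cdf μ t}
  have hne : A.Nonempty := by
    obtain ⟨t, ht⟩ := ((ProbabilityTheory.tendsto_cdf_atTop μ).eventually (lt_mem_nhds h1)).exists
    exact ⟨t, ht.le⟩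
  have hbdd : BddBelow A := by
    obtain ⟨t, ht⟩ := ((ProbabilityTheory.tendsto_cdf_atBot μ).eventually (gt_mem_nhds h0)).exists
    refine ⟨t, fun s hs => ?_⟩
    by_contra! hst
    exact absurd (hs.trans (ProbabilityTheory.monotone_cdf μ hst.le)) (not_le.mpr ht)
  refine ⟨sInf A, ?_, ?_⟩
  · have hlim : Function.leftLim (ProbabilityTheory.cdf μ) (sInf A) ≤ τ := by
      refine le_of_tendsto ((ProbabilityTheory.monotone_cdf μ).tendsto_leftLim (sInf A)) ?_
      filter_upwards [self_mem_nhdsWithin] with t ht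
      by_contra! h
      exact absurd (csInf_le hbdd (show t ∈ A from h.le)) (not_le.mpr ht)
    rw [← ProbabilityTheory.measure_cdf μ, measureReal_def,
      StieltjesFunction.measure_Iio _ (ProbabilityTheory.tendsto_cdf_atBot μ), sub_zero]
    exact ENNReal.toReal_le_of_le_ofReal h0.le (ENNReal.ofReal_le_ofReal hlim)
  · rw [← ProbabilityTheory.cdf_eq_real]
    refine ge_of_tendsto (((ProbabilityTheory.cdf μ).right_continuous (sInf A)).mono_left
      (nhdsWithin_mono _ Set.Ioi_subset_Ici_self)) ?_
    filter_upwards [self_mem_nhdsWithin] with t ht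
    obtain ⟨s, hs, hst⟩ := exists_lt_of_csInf_lt hne ht
    exact le_trans hs (ProbabilityTheory.monotone_cdf μ hst.le)

/-- A randomized lower-tail indicator of `v` of total mass `τ`. -/
lemma exists_lowerTail_weight {S : Type*} [MeasurableSpace S]
    (P : Measure S) [IsProbabilityMeasure P] {v : S → ℝ}
    (hv : Measurable v) {τ : ℝ} (h0 : 0 < τ) (h1 : τ < 1) :
    ∃ (b : ℝ) (w : S → ℝ), Measurable w ∧ (∀ x, 0 ≤ w x) ∧ (∀ x, w x ≤ 1) ∧
      (∀ x, v x < b → w x = 1) ∧ (∀ x, b < v x → w x = 0) ∧ ∫ x, w x ∂P = τ := by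
  have := Measure.isProbabilityMeasure_map (μ := P) hv.aemeasurable
  obtain ⟨b, hlo, hhi⟩ := exists_quantile (P.map v) h0 h1
  have hsplit : (P.map v).real (Set.Iic b) =
      (P.map v).real (Set.Iio b) + (P.map v).real {b} := by
    rw [← Set.Iio_union_right, measureReal_union (by simp) (measurableSet_singleton b)]
  rw [map_measureReal_apply hv measurableSet_Iio] at hlo hsplit
  rw [map_measureReal_apply hv measurableSet_Iic] at hhi hsplit
  rw [map_measureReal_apply hv (measurableSet_singleton b)] at hsplit
  set p := P.real (v ⁻¹' Set.Iio b)
  set q := P.real (v ⁻¹' {b})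
  obtain ⟨c, hc0, hc1, hc⟩ : ∃ c : ℝ, 0 ≤ c ∧ c ≤ 1 ∧ p + q * c = τ := by
    have hq : 0 ≤ q := measureReal_nonneg
    rcases hq.eq_or_lt with hq | hq
    · exact ⟨0, le_rfl, zero_le_one, by linarith⟩
    · refine ⟨(τ - p) / q, div_nonneg (by linarith) hq.le, ?_, by field_simp; ring⟩
      rw [div_le_one hq]
      linarith
  have hm1 : MeasurableSet (v ⁻¹' Set.Iio b) := hv measurableSet_Iio
  have hm2 : MeasurableSet (v ⁻¹' {b}) := hv (measurableSet_singleton b)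
  refine ⟨b, fun x => (v ⁻¹' Set.Iio b).indicator (fun _ => (1 : ℝ)) x +
    (v ⁻¹' {b}).indicator (fun _ => c) x,
    (measurable_const.indicator hm1).add (measurable_const.indicator hm2), ?_, ?_, ?_, ?_, ?_⟩
  · exact fun x => add_nonneg (Set.indicator_nonneg (fun _ _ => zero_le_one) x)
      (Set.indicator_nonneg (fun _ _ => hc0) x)
  · intro x
    rcases lt_trichotomy (v x) b with h | h | h
    · simp [Set.indicator, h, h.ne]
    · simp [Set.indicator, h, hc1]
    · simp [Set.indicator, h.not_gt, h.ne']
  · intro x h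
    simp [Set.indicator, h, h.ne]
  · intro x h
    simp [Set.indicator, h.not_gt, h.ne']
  · rw [integral_add ((integrable_const _).indicator hm1) ((integrable_const _).indicator hm2),
      integral_indicator_const _ hm1, integral_indicator_const _ hm2]
    simpa using hc

/-- The supremum defining the lower CVaR is attained at a quantile. -/
lemma cvarLower_eq_integral_weight {S : Type*} [MeasurableSpace S]
    (P : Measure S) [IsProbabilityMeasure P] {v w : S → ℝ}
    {τ b : ℝ} (hv : Integrable v P) (hw : Integrable w P)
    (hwv : Integrable (fun x => w x * v x) P) (h0 : 0 < τ)
    (hw0 : ∀ x, 0 ≤ w x) (hw1 : ∀ x, w x ≤ 1) (hlt : ∀ x, v x < b → w x = 1)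
    (hgt : ∀ x, b < v x → w x = 0) (hwτ : ∫ x, w x ∂P = τ) :
    cvarLower τ v P = τ⁻¹ * ∫ x, w x * v x ∂P := by
  have hint : ∀ a : ℝ, Integrable (fun x => w x * (v x - a)) P := fun a => by
    simp_rw [mul_sub]
    exact hwv.sub (hw.mul_const a)
  have hval : ∀ a : ℝ, τ⁻¹ * ∫ x, w x * v x ∂P = a + τ⁻¹ * ∫ x, w x * (v x - a) ∂P := by
    intro a
    simp_rw [mul_sub]
    rw [integral_sub hwv (hw.mul_const a), integral_mul_const, hwτ]
    field_simp
    ring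
  have hgreatest : IsGreatest (Set.range fun a : ℝ => a + τ⁻¹ * ∫ x, min (v x - a) 0 ∂P)
      (τ⁻¹ * ∫ x, w x * v x ∂P) := by
    constructor
    · refine ⟨b, ?_⟩
      rw [hval b]
      refine congrArg (fun t => b + τ⁻¹ * t) (integral_congr_ae (ae_of_all _ fun x => ?_))
      simp only
      rcases lt_trichotomy (v x) b with h | h | h
      · rw [hlt x h, one_mul, min_eq_left (by linarith)]
      · simp [h]
      · rw [hgt x h, zero_mul, min_eq_right (by linarith)]
    · rintro _ ⟨a, rfl⟩
      rw [hval a]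
      refine add_le_add_right (mul_le_mul_of_nonneg_left ?_ (inv_nonneg.mpr h0.le)) a
      refine integral_mono ((hv.sub (integrable_const a)).inf (integrable_const 0)) (hint a)
        fun x => ?_
      rcases le_total (v x - a) 0 with h | h
      · exact (min_le_left _ _).trans (by nlinarith [hw1 x])
      · exact (min_le_right _ _).trans (mul_nonneg (hw0 x) h)
  exact hgreatest.csSup_eq

/-- The infimum of `∫ v dU` over the perturbation set `U_Λ(P)` equals
`Λ⁻¹ ∫ v dP + (1 − Λ⁻¹) CVaR⁻_τ(v;P)` with `τ = 1/(Λ+1)`. -/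
theorem inf_over_perturbSet_eq_cvarLower
    {S : Type*} [MeasurableSpace S] (P : Measure S) [IsProbabilityMeasure P]
    (v : S → ℝ) (hv_meas : Measurable v) (M : ℝ) (hv_bdd : ∀ x, |v x| ≤ M)
    (Λ : ℝ) (hΛ : 1 ≤ Λ) :
    sInf ((fun U : Measure S => ∫ x, v x ∂U) '' perturbSet Λ P) =
      Λ⁻¹ * ∫ x, v x ∂P + (1 - Λ⁻¹) * cvarLower (Λ + 1)⁻¹ v P := by
  have hΛ0 : 0 < Λ := by linarith
  have hinv : Λ⁻¹ ≤ Λ := (inv_le_one_of_one_le₀ hΛ).trans hΛ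
  have hinv0 : 0 < Λ⁻¹ := inv_pos.mpr hΛ0
  have hτ0 : 0 < (Λ + 1)⁻¹ := by positivity
  have hτ1 : (Λ + 1)⁻¹ < 1 := inv_lt_one_of_one_lt₀ (by linarith)
  obtain ⟨b, w, hwm, hw0, hw1, hlt, hgt, hwτ⟩ := exists_lowerTail_weight P hv_meas hτ0 hτ1
  have hmulv : ∀ {f : S → ℝ}, Integrable f P → Integrable (fun x => f x * v x) P := fun hf =>
    hf.mul_bdd (c := M) hv_meas.aestronglyMeasurable (ae_of_all _ hv_bdd)
  have hv : Integrable v P := by simpa using hmulv (integrable_const 1)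
  have hw : Integrable w P := .of_bound hwm.aestronglyMeasurable 1
    (ae_of_all _ fun x => by rw [Real.norm_of_nonneg (hw0 x)]; exact hw1 x)
  have hwv := hmulv hw
  rw [cvarLower_eq_integral_weight P hv hw hwv hτ0 hw0 hw1 hlt hgt hwτ]
  set g : S → ℝ := fun x => Λ⁻¹ + (Λ - Λ⁻¹) * w x with hg
  have hgi : Integrable g P := (integrable_const _).add (hw.const_mul _)
  have hgm : Measurable g := measurable_const.add (hwm.const_mul _)
  have hglo : ∀ x, Λ⁻¹ ≤ g x := fun x => by
    simpa [hg] using mul_nonneg (sub_nonneg.mpr hinv) (hw0 x)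
  have hghi : ∀ x, g x ≤ Λ := fun x => by
    simp only [hg]
    nlinarith [hw1 x]
  have hg0 : ∀ x, 0 ≤ g x := fun x => hinv0.le.trans (hglo x)
  have hg1 : ∫ x, g x ∂P = 1 := by
    simp only [hg]
    rw [integral_add (integrable_const _) (hw.const_mul _), integral_const_mul, hwτ]
    simp only [integral_const, probReal_univ, one_smul]
    field_simp
    ring
  have hgv : Λ⁻¹ * ∫ x, v x ∂P + (1 - Λ⁻¹) * ((Λ + 1)⁻¹⁻¹ * ∫ x, w x * v x ∂P) =
      ∫ x, g x * v x ∂P := by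
    simp only [hg, add_mul, mul_assoc]
    rw [integral_add (hv.const_mul _) (hwv.const_mul _), integral_const_mul, integral_const_mul,
      inv_inv]
    field_simp
    ring
  rw [hgv]
  refine IsLeast.csInf_eq ⟨?_, ?_⟩
  · refine ⟨P.withDensity fun x => ENNReal.ofReal (g x), ⟨⟨?_⟩,
      withDensity_absolutelyContinuous _ _, ?_⟩, ?_⟩
    · rw [withDensity_apply _ .univ, Measure.restrict_univ,
        ← ofReal_integral_eq_lintegral_ofReal hgi (ae_of_all _ hg0), hg1, ENNReal.ofReal_one]
    · filter_upwards [Measure.rnDeriv_withDensity P hgm.ennreal_ofReal] with x hx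
      rw [hx]
      exact ⟨ENNReal.ofReal_le_ofReal (hglo x), ENNReal.ofReal_le_ofReal (hghi x)⟩
    · simp only
      rw [integral_withDensity_eq_integral_toReal_smul hgm.ennreal_ofReal
        (ae_of_all _ fun _ => ENNReal.ofReal_lt_top)]
      simp only [ENNReal.toReal_ofReal (hg0 _), smul_eq_mul]
  · rintro _ ⟨U, ⟨hU, hUP, hUb⟩, rfl⟩
    simp only
    set r : S → ℝ := fun x => (U.rnDeriv P x).toReal
    have hri : Integrable r P := Measure.integrable_toReal_rnDeriv
    have hr1 : ∫ x, r x ∂P = 1 := by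
      rw [Measure.integral_toReal_rnDeriv hUP, probReal_univ]
    have hrv : ∫ x, r x * v x ∂P = ∫ x, v x ∂U := integral_rnDeriv_smul hUP
    have hnonneg : 0 ≤ ∫ x, ((r x * v x - g x * v x) - (r x - g x) * b) ∂P := by
      refine integral_nonneg_of_ae ?_
      filter_upwards [hUb] with x ⟨hx1, hx2⟩
      have hrlo : Λ⁻¹ ≤ r x :=
        (ENNReal.ofReal_le_iff_le_toReal (hx2.trans_lt ENNReal.ofReal_lt_top).ne).mp hx1
      have hrhi : r x ≤ Λ := ENNReal.toReal_le_of_le_ofReal hΛ0.le hx2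
      have hfactor : (r x * v x - g x * v x) - (r x - g x) * b = (r x - g x) * (v x - b) := by
        ring
      rw [Pi.zero_apply, hfactor]
      rcases lt_trichotomy (v x) b with h | h | h
      · have : g x = Λ := by simp [hg, hlt x h]
        exact mul_nonneg_of_nonpos_of_nonpos (by linarith) (by linarith)
      · simp [h]
      · have : g x = Λ⁻¹ := by simp [hg, hgt x h]
        exact mul_nonneg (by linarith) (by linarith)
    have hdiff : Integrable (fun x => r x * v x - g x * v x) P := (hmulv hri).sub (hmulv hgi)
    have hdiffb : Integrable (fun x => (r x - g x) * b) P := (hri.sub hgi).mul_const b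
    rw [integral_sub hdiff hdiffb,
      integral_sub (hmulv hri) (hmulv hgi), integral_mul_const, integral_sub hri hgi,
      hr1, hg1, hrv] at hnonneg
    linarith
end

section
/- Let S be a measurable space, P a probability measure on S, v : S → ℝ a bounded measurable function, Λ ∈ [1,∞), and τ := 1/(Λ+1). Then the supremum of ∫ v dU over all U in the perturbation set U_Λ(P) equals Λ⁻¹ ∫ v dP + (1 − Λ⁻¹) · CVaR⁺_τ(v; P). -/
open MeasureTheory

/-- Upper conditional value-at-risk at level `τ`:
`CVaR⁺_τ(v;P) = inf_{b ∈ ℝ} (b + τ⁻¹ ∫ max(v x − b, 0) dP)`. -/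
noncomputable def cvarUpper {S : Type*} [MeasurableSpace S] (τ : ℝ) (v : S → ℝ)
    (P : Measure S) : ℝ :=
  ⨅ b : ℝ, b + τ⁻¹ * ∫ x, max (v x - b) 0 ∂P

/-- Every probability measure on `ℝ` has an upper `τ`-quantile for each `τ ∈ (0, 1)`. -/
lemma exists_upper_quantile (μ : Measure ℝ) [IsProbabilityMeasure μ] {τ : ℝ}
    (hτ₀ : 0 < τ) (hτ₁ : τ < 1) :
    ∃ b, μ.real (Set.Ioi b) ≤ τ ∧ τ ≤ μ.real (Set.Ici b) := by
  let F := ProbabilityTheory.cdf μ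
  let A : Set ℝ := {b | 1 - τ ≤ F b}
  have hne : A.Nonempty :=
    (((ProbabilityTheory.tendsto_cdf_atTop μ).eventually
      (eventually_ge_nhds (by linarith : 1 - τ < 1)))).exists
  have hbdd : BddBelow A := by
    obtain ⟨a, ha⟩ := (((ProbabilityTheory.tendsto_cdf_atBot μ).eventually
      (eventually_lt_nhds (by linarith : 0 < 1 - τ)))).exists
    refine ⟨a, fun b hb => ?_⟩
    by_contra! h
    exact absurd ((hb.trans (F.mono h.le)).trans_lt ha) (lt_irrefl _)
  refine ⟨sInf A, ?_, ?_⟩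
  · have hF : 1 - τ ≤ F (sInf A) := by
      have hcont : Filter.Tendsto F (nhdsWithin (sInf A) (Set.Ioi (sInf A)))
          (nhds (F (sInf A))) :=
        (F.right_continuous (sInf A)).mono_left (nhdsWithin_mono _ Set.Ioi_subset_Ici_self)
      refine ge_of_tendsto hcont ?_
      filter_upwards [self_mem_nhdsWithin] with x hx
      obtain ⟨a, ha, hax⟩ := exists_lt_of_csInf_lt hne hx
      exact le_trans ha (F.mono hax.le)
    rw [← Set.compl_Iic, probReal_compl_eq_one_sub measurableSet_Iic,
      ← ProbabilityTheory.cdf_eq_real]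
    linarith
  · have hleft : Function.leftLim F (sInf A) ≤ 1 - τ := by
      refine le_of_tendsto (F.mono.tendsto_leftLim _) ?_
      filter_upwards [self_mem_nhdsWithin] with x hx
      exact (not_le.1 (notMem_of_lt_csInf (s := A) hx hbdd)).le
    have hIci : μ (Set.Ici (sInf A)) = ENNReal.ofReal (1 - Function.leftLim F (sInf A)) := by
      conv_lhs => rw [← ProbabilityTheory.measure_cdf μ]
      exact StieltjesFunction.measure_Ici _ (ProbabilityTheory.tendsto_cdf_atTop μ) _
    rw [measureReal_def, hIci, ENNReal.toReal_ofReal (by linarith)]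
    linarith

section

variable {S : Type*} [MeasurableSpace S] {P : Measure S} {v : S → ℝ} {Λ : ℝ}

lemma integrable_max_sub_const [IsFiniteMeasure P] (hv : Integrable v P) (b : ℝ) :
    Integrable (fun x => max (v x - b) 0) P :=
  (hv.sub (integrable_const b)).pos_part

lemma integral_le_of_mem_perturbSet [IsProbabilityMeasure P] (hv : Integrable v P)
    (hΛ : 1 ≤ Λ) {U : Measure S} (hU : U ∈ perturbSet Λ P) (hvU : Integrable v U) (b : ℝ) :
    ∫ x, v x ∂U ≤
      Λ⁻¹ * ∫ x, v x ∂P + (1 - Λ⁻¹) * (b + (Λ + 1) * ∫ x, max (v x - b) 0 ∂P) := by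
  obtain ⟨hprob, hac, hden⟩ := hU
  have hΛ₀ : 0 < Λ := by linarith
  have hΛinv : Λ⁻¹ * Λ = 1 := inv_mul_cancel₀ hΛ₀.ne'
  have hvb : Integrable (fun x => v x - b) P := hv.sub (integrable_const b)
  have hmax := integrable_max_sub_const hv b
  have hle : ∫ x, (v x - b) ∂U ≤
      ∫ x, (Λ⁻¹ * (v x - b) + (Λ - Λ⁻¹) * max (v x - b) 0) ∂P := by
    rw [← integral_rnDeriv_smul hac]
    refine integral_mono_ae ((integrable_rnDeriv_smul_iff hac).2
      (hvU.sub (integrable_const b))) ((hvb.const_mul _).add (hmax.const_mul _)) ?_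
    filter_upwards [hden] with x hx
    have hlow : Λ⁻¹ ≤ (U.rnDeriv P x).toReal :=
      (ENNReal.ofReal_le_iff_le_toReal (hx.2.trans_lt ENNReal.ofReal_lt_top).ne).1 hx.1
    have hupp : (U.rnDeriv P x).toReal ≤ Λ := ENNReal.toReal_le_of_le_ofReal hΛ₀.le hx.2
    simp only [smul_eq_mul]
    rcases le_total (v x - b) 0 with h | h
    · rw [max_eq_right h]
      nlinarith
    · rw [max_eq_left h]
      nlinarith
  rw [integral_add (hvb.const_mul _) (hmax.const_mul _), integral_const_mul, integral_const_mul,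
    integral_sub hv (integrable_const b), integral_sub hvU (integrable_const b)] at hle
  simp only [integral_const, probReal_univ, one_smul] at hle
  linear_combination hle + (∫ x, max (v x - b) 0 ∂P) * (hΛinv)

lemma withDensity_mem_perturbSet [IsProbabilityMeasure P] {f : S → ℝ} (hf : Measurable f)
    (hΛ : 0 ≤ Λ⁻¹) (hlow : ∀ x, Λ⁻¹ ≤ f x) (hupp : ∀ x, f x ≤ Λ) (hone : ∫ x, f x ∂P = 1) :
    P.withDensity (fun x => ENNReal.ofReal (f x)) ∈ perturbSet Λ P := by
  have hint : Integrable f P := by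
    by_contra h
    simp [integral_undef h] at hone
  refine ⟨⟨?_⟩, withDensity_absolutelyContinuous _ _, ?_⟩
  · rw [withDensity_apply _ MeasurableSet.univ, Measure.restrict_univ,
      ← ofReal_integral_eq_lintegral_ofReal hint (.of_forall fun x => hΛ.trans (hlow x)), hone,
      ENNReal.ofReal_one]
  · filter_upwards [Measure.rnDeriv_withDensity P hf.ennreal_ofReal] with x hx
    rw [hx]
    exact ⟨ENNReal.ofReal_le_ofReal (hlow x), ENNReal.ofReal_le_ofReal (hupp x)⟩

/-- A density with values in `[0, τ⁻¹]` concentrated on the upper `τ`-tail of `v`. -/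
lemma exists_tail_density [IsProbabilityMeasure P] (hv_meas : Measurable v)
    (hv : Integrable v P) {τ : ℝ} (hτ₀ : 0 < τ) (hτ₁ : τ < 1) :
    ∃ (b : ℝ) (g : S → ℝ), Measurable g ∧ (∀ x, 0 ≤ g x ∧ g x ≤ τ⁻¹) ∧ ∫ x, g x ∂P = 1 ∧
      ∫ x, g x * v x ∂P = b + τ⁻¹ * ∫ x, max (v x - b) 0 ∂P := by
  have : IsProbabilityMeasure (P.map v) := Measure.isProbabilityMeasure_map hv_meas.aemeasurable
  obtain ⟨b, hIoi, hIci⟩ := exists_upper_quantile (P.map v) hτ₀ hτ₁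
  have hsum : (P.map v).real (Set.Ici b) = (P.map v).real {b} + (P.map v).real (Set.Ioi b) := by
    rw [← measureReal_union (by simp) measurableSet_Ioi]
    congr 1
    ext x
    simp [le_iff_eq_or_lt]
  rw [hsum] at hIci
  obtain ⟨θ, hθ₀, hθ₁, hθ⟩ : ∃ θ : ℝ, 0 ≤ θ ∧ θ ≤ 1 ∧
      (P.map v).real (Set.Ioi b) + θ * (P.map v).real {b} = τ := by
    rcases (measureReal_nonneg (μ := P.map v) (s := {b})).eq_or_lt with h | h
    · exact ⟨0, le_rfl, zero_le_one, by linarith⟩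
    · refine ⟨(τ - (P.map v).real (Set.Ioi b)) / (P.map v).real {b},
        div_nonneg (by linarith) h.le, (div_le_one h).2 (by linarith), ?_⟩
      rw [div_mul_cancel₀ _ h.ne']
      ring
  rw [map_measureReal_apply hv_meas measurableSet_Ioi,
    map_measureReal_apply hv_meas (measurableSet_singleton b)] at hθ
  have hτinv : 0 ≤ τ⁻¹ := (inv_pos.2 hτ₀).le
  let g : S → ℝ := fun x => τ⁻¹ * ((v ⁻¹' Set.Ioi b).indicator (fun _ => 1) x
    + θ * (v ⁻¹' {b}).indicator (fun _ => 1) x)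
  have hmIoi : MeasurableSet (v ⁻¹' Set.Ioi b) := hv_meas measurableSet_Ioi
  have hmb : MeasurableSet (v ⁻¹' {b}) := hv_meas (measurableSet_singleton b)
  have hg_meas : Measurable g :=
    ((measurable_const.indicator hmIoi).add
      ((measurable_const.indicator hmb).const_mul θ)).const_mul _
  have hiIoi : Integrable ((v ⁻¹' Set.Ioi b).indicator (fun _ => (1 : ℝ))) P :=
    (integrable_const 1).indicator hmIoi
  have hib : Integrable ((v ⁻¹' {b}).indicator (fun _ => (1 : ℝ))) P :=
    (integrable_const 1).indicator hmb
  have hg_int : Integrable g P := (hiIoi.add (hib.const_mul θ)).const_mul _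
  have hg_one : ∫ x, g x ∂P = 1 := by
    rw [integral_const_mul, integral_add hiIoi (hib.const_mul θ), integral_const_mul,
      integral_indicator_const _ hmIoi, integral_indicator_const _ hmb]
    simp only [smul_eq_mul, mul_one]
    rw [hθ, inv_mul_cancel₀ hτ₀.ne']
  refine ⟨b, g, hg_meas, fun x => ?_, hg_one, ?_⟩
  · have hmem : 0 ≤ (v ⁻¹' Set.Ioi b).indicator (fun _ => (1 : ℝ)) x
        + θ * (v ⁻¹' {b}).indicator (fun _ => 1) x ∧
        (v ⁻¹' Set.Ioi b).indicator (fun _ => (1 : ℝ)) x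
        + θ * (v ⁻¹' {b}).indicator (fun _ => 1) x ≤ 1 := by
      rcases lt_trichotomy (v x) b with h | h | h
      · simp [Set.indicator, h.not_gt, h.ne]
      · simp [Set.indicator, h, hθ₀, hθ₁]
      · simp [Set.indicator, h, h.ne']
    exact ⟨mul_nonneg hτinv hmem.1, mul_le_of_le_one_right hτinv hmem.2⟩
  · have hpt : ∀ x, g x * v x = b * g x + τ⁻¹ * max (v x - b) 0 := fun x => by
      rcases lt_trichotomy (v x) b with h | h | h
      · simp [g, Set.indicator, h.not_gt, h.ne, h.le]
      · simp [g, Set.indicator, h]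
        ring
      · simp [g, Set.indicator, h, h.ne', h.le]
        ring
    simp_rw [hpt]
    rw [integral_add (hg_int.const_mul b) ((integrable_max_sub_const hv b).const_mul _),
      integral_const_mul b g, hg_one, integral_const_mul, mul_one]

lemma exists_mem_perturbSet_integral_eq [IsProbabilityMeasure P] (hv_meas : Measurable v)
    (hv : Integrable v P) (hΛ : 1 ≤ Λ) :
    ∃ U ∈ perturbSet Λ P, ∃ b : ℝ, ∫ x, v x ∂U =
      Λ⁻¹ * ∫ x, v x ∂P + (1 - Λ⁻¹) * (b + (Λ + 1) * ∫ x, max (v x - b) 0 ∂P) := by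
  obtain ⟨b, g, hg_meas, hg_mem, hg_one, hg_v⟩ := exists_tail_density (τ := (Λ + 1)⁻¹) hv_meas hv
    (by positivity) (inv_lt_one_of_one_lt₀ (by linarith))
  rw [inv_inv] at hg_mem hg_v
  have hΛ₀ : 0 < Λ := by linarith
  have hΛ_inv : 0 ≤ Λ⁻¹ := (inv_pos.2 hΛ₀).le
  have hc : 0 ≤ 1 - Λ⁻¹ := sub_nonneg.2 (inv_le_one_of_one_le₀ hΛ)
  have hmul : Λ⁻¹ * Λ = 1 := inv_mul_cancel₀ hΛ₀.ne'
  have hg_int : Integrable g P := by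
    by_contra h
    simp [integral_undef h] at hg_one
  let f : S → ℝ := fun x => Λ⁻¹ + (1 - Λ⁻¹) * g x
  have hf_meas : Measurable f := (hg_meas.const_mul _).const_add _
  have hlow : ∀ x, Λ⁻¹ ≤ f x := fun x => le_add_of_nonneg_right (mul_nonneg hc (hg_mem x).1)
  have hupp : ∀ x, f x ≤ Λ := fun x => by
    have := mul_le_mul_of_nonneg_left (hg_mem x).2 hc
    simp only [f]
    linarith
  have hf_one : ∫ x, f x ∂P = 1 := by
    rw [integral_add (integrable_const _) (hg_int.const_mul _), integral_const_mul, hg_one]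
    simp
  refine ⟨_, withDensity_mem_perturbSet hf_meas hΛ_inv hlow hupp hf_one, b, ?_⟩
  have hgv_int : Integrable (fun x => g x * v x) P :=
    hv.bdd_mul (c := Λ + 1) hg_meas.aestronglyMeasurable
      (.of_forall fun x => by rw [Real.norm_of_nonneg (hg_mem x).1]; exact (hg_mem x).2)
  rw [integral_withDensity_eq_integral_toReal_smul hf_meas.ennreal_ofReal
    (.of_forall fun _ => ENNReal.ofReal_lt_top), ← hg_v, ← integral_const_mul,
    ← integral_const_mul, ← integral_add (hv.const_mul _) (hgv_int.const_mul _)]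
  congr 1
  ext x
  rw [ENNReal.toReal_ofReal (hΛ_inv.trans (hlow x)), smul_eq_mul]
  ring

lemma integral_le_add_mul_integral_max [IsProbabilityMeasure P] (hv : Integrable v P) {c : ℝ}
    (hc : 1 ≤ c) (b : ℝ) : ∫ x, v x ∂P ≤ b + c * ∫ x, max (v x - b) 0 ∂P := by
  have hle : ∫ x, (v x - b) ∂P ≤ ∫ x, max (v x - b) 0 ∂P :=
    integral_mono (hv.sub (integrable_const b)) (integrable_max_sub_const hv b)
      fun x => le_max_left _ _
  have hnonneg : 0 ≤ ∫ x, max (v x - b) 0 ∂P := integral_nonneg fun x => le_max_right _ _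
  rw [integral_sub hv (integrable_const b)] at hle
  simp only [integral_const, probReal_univ, one_smul] at hle
  linarith [le_mul_of_one_le_left hnonneg hc]

end

/-- The supremum of `∫ v dU` over the perturbation set `U_Λ(P)` equals
`Λ⁻¹ ∫ v dP + (1 − Λ⁻¹) CVaR⁺_τ(v;P)` with `τ = 1/(Λ+1)`. -/
theorem sup_over_perturbSet_eq_cvarUpper
    {S : Type*} [MeasurableSpace S] (P : Measure S) [IsProbabilityMeasure P]
    (v : S → ℝ) (hv_meas : Measurable v) (M : ℝ) (hv_bdd : ∀ x, |v x| ≤ M)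
    (Λ : ℝ) (hΛ : 1 ≤ Λ) :
    sSup ((fun U : Measure S => ∫ x, v x ∂U) '' perturbSet Λ P) =
      Λ⁻¹ * ∫ x, v x ∂P + (1 - Λ⁻¹) * cvarUpper (Λ + 1)⁻¹ v P := by
  have hint : ∀ U : Measure S, IsProbabilityMeasure U → Integrable v U := fun U _ =>
    .of_bound hv_meas.aestronglyMeasurable M (.of_forall hv_bdd)
  have hv : Integrable v P := hint P inferInstance
  have hc : 0 ≤ 1 - Λ⁻¹ := sub_nonneg.2 (inv_le_one_of_one_le₀ hΛ)
  obtain ⟨U₀, hU₀, b₀, hb₀⟩ := exists_mem_perturbSet_integral_eq hv_meas hv hΛ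
  have hupper : ∀ U ∈ perturbSet Λ P, ∫ x, v x ∂U ≤
      Λ⁻¹ * ∫ x, v x ∂P + (1 - Λ⁻¹) * cvarUpper (Λ + 1)⁻¹ v P := fun U hU => by
    rw [cvarUpper, Real.mul_iInf_of_nonneg hc, ← sub_le_iff_le_add']
    refine le_ciInf fun b => ?_
    rw [inv_inv, sub_le_iff_le_add']
    exact integral_le_of_mem_perturbSet hv hΛ hU (hint U hU.1) b
  have hcvar : cvarUpper (Λ + 1)⁻¹ v P ≤ b₀ + (Λ + 1) * ∫ x, max (v x - b₀) 0 ∂P := by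
    rw [cvarUpper, inv_inv]
    refine ciInf_le ⟨∫ x, v x ∂P, ?_⟩ b₀
    rintro _ ⟨b, rfl⟩
    exact integral_le_add_mul_integral_max hv (by linarith) b
  refine IsGreatest.csSup_eq ⟨⟨U₀, hU₀, (hupper U₀ hU₀).antisymm ?_⟩, ?_⟩
  · rw [hb₀]
    gcongr
  · rintro _ ⟨U, hU, rfl⟩
    exact hupper U hU
end

section
/- Let S be a measurable space, P a probability measure on S, v : S → ℝ a bounded measurable function, Λ ∈ (1,∞), and τ := 1/(Λ+1). Suppose β⁻ ∈ ℝ satisfies P(v ≤ β⁻) = τ, and define the measure U⁻ by dU⁻/dP (s') := Λ⁻¹ + (1 − Λ⁻¹) τ⁻¹ · 1[v(s') ≤ β⁻]. Then U⁻ is a probability measure belonging to the perturbation set U_Λ(P), and ∫ v dU⁻ = inf_{U ∈ U_Λ(P)} ∫ v dU. Symmetrically, if β⁺ ∈ ℝ satisfies P(v ≥ β⁺) = τ, then U⁺ with dU⁺/dP (s') := Λ⁻¹ + (1 − Λ⁻¹) τ⁻¹ · 1[v(s') ≥ β⁺] is a probability measure in U_Λ(P) and ∫ v dU⁺ = sup_{U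 ∈ U_Λ(P)} ∫ v dU. -/
open MeasureTheory

/-- The expectation of a bounded function is minimised over `perturbSet Λ P` by any member whose
density is `Λ` on a sublevel set and `Λ⁻¹` off it. -/
lemma integral_le_of_mem_perturbSet_s3 {S : Type*} [MeasurableSpace S] {P : Measure S}
    [IsProbabilityMeasure P] {v : S → ℝ} (hv_meas : Measurable v) {M : ℝ}
    (hv_bdd : ∀ x, |v x| ≤ M) {Λ : ℝ} (hΛ : 1 < Λ) {β : ℝ} {U₀ U : Measure S}
    (hU₀ : U₀ ∈ perturbSet Λ P) (hU : U ∈ perturbSet Λ P)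
    (hdens : ∀ᵐ x ∂P, U₀.rnDeriv P x = ENNReal.ofReal (if v x ≤ β then Λ else Λ⁻¹)) :
    ∫ x, v x ∂U₀ ≤ ∫ x, v x ∂U := by
  obtain ⟨hU₀_prob, hU₀_ac, -⟩ := hU₀
  obtain ⟨hU_prob, hU_ac, hU_bd⟩ := hU
  have hint : ∀ (Q : Measure S) [IsProbabilityMeasure Q], Integrable v Q := fun Q _ =>
    Integrable.of_bound hv_meas.aestronglyMeasurable M (.of_forall fun x => hv_bdd x)
  have hint' : ∀ (Q : Measure S) [IsProbabilityMeasure Q], Integrable (fun x => v x - β) Q :=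
    fun Q _ => (hint Q).sub (integrable_const β)
  have hsub : ∀ (Q : Measure S) [IsProbabilityMeasure Q],
      ∫ x, (v x - β) ∂Q = ∫ x, v x ∂Q - β := fun Q _ => by
    rw [integral_sub (hint Q) (integrable_const β)]
    simp
  have hmono : ∫ x, (U₀.rnDeriv P x).toReal • (v x - β) ∂P
      ≤ ∫ x, (U.rnDeriv P x).toReal • (v x - β) ∂P := by
    refine integral_mono_ae ((integrable_rnDeriv_smul_iff hU₀_ac).mpr (hint' U₀))
      ((integrable_rnDeriv_smul_iff hU_ac).mpr (hint' U)) ?_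
    filter_upwards [hdens, hU_bd] with x hx hbd
    have hne : U.rnDeriv P x ≠ ⊤ := ne_top_of_le_ne_top ENNReal.ofReal_ne_top hbd.2
    have hlow : Λ⁻¹ ≤ (U.rnDeriv P x).toReal := (ENNReal.ofReal_le_iff_le_toReal hne).mp hbd.1
    have hup : (U.rnDeriv P x).toReal ≤ Λ :=
      ENNReal.toReal_le_of_le_ofReal (by linarith) hbd.2
    have hinv : 0 ≤ Λ⁻¹ := by positivity
    simp only [hx, smul_eq_mul]
    split_ifs with h
    · rw [ENNReal.toReal_ofReal (by linarith)]
      exact mul_le_mul_of_nonpos_right hup (by linarith)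
    · rw [ENNReal.toReal_ofReal hinv]
      exact mul_le_mul_of_nonneg_right hlow (by linarith)
  rw [integral_rnDeriv_smul hU₀_ac, integral_rnDeriv_smul hU_ac, hsub, hsub] at hmono
  linarith

/-- The tilted density takes the value `Λ` where the indicator is one and `Λ⁻¹` elsewhere. -/
lemma tilted_density_eq {Λ τ : ℝ} (hΛ : 1 < Λ) (hτ : τ = (Λ + 1)⁻¹) (p : Prop) [Decidable p] :
    Λ⁻¹ + (1 - Λ⁻¹) * τ⁻¹ * (if p then 1 else 0) = if p then Λ else Λ⁻¹ := by
  have h0 : Λ ≠ 0 := by linarith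
  subst hτ
  split_ifs
  · field_simp
    ring
  · ring

/-- The measure with density `Λ` on a set of mass `(Λ + 1)⁻¹` and `Λ⁻¹` off it is a probability
measure. -/
lemma isProbabilityMeasure_withDensity_ite {S : Type*} [MeasurableSpace S] {P : Measure S}
    [IsProbabilityMeasure P] {p : S → Prop} [DecidablePred p] (hp : MeasurableSet {x | p x})
    {Λ : ℝ} (hΛ : 1 < Λ) (hP : P {x | p x} = ENNReal.ofReal (Λ + 1)⁻¹) :
    IsProbabilityMeasure (P.withDensity fun x => ENNReal.ofReal (if p x then Λ else Λ⁻¹)) := by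
  have hc : 0 ≤ Λ - Λ⁻¹ := by linarith [inv_lt_one_of_one_lt₀ hΛ]
  have hinv : 0 ≤ Λ⁻¹ := by positivity
  have hsplit : (fun x => ENNReal.ofReal (if p x then Λ else Λ⁻¹)) = fun x =>
      ENNReal.ofReal Λ⁻¹ + {x | p x}.indicator (fun _ => ENNReal.ofReal (Λ - Λ⁻¹)) x := by
    funext x
    by_cases h : p x
    · simp [h, ← ENNReal.ofReal_add hinv hc]
    · simp [h]
  constructor
  rw [withDensity_apply _ MeasurableSet.univ, Measure.restrict_univ, hsplit,
    lintegral_add_left measurable_const, lintegral_indicator_const hp, lintegral_const,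
    measure_univ, mul_one, hP, ← ENNReal.ofReal_mul hc,
    ← ENNReal.ofReal_add hinv (mul_nonneg hc (by positivity)), ← ENNReal.ofReal_one]
  congr 1
  field_simp
  ring

/-- The lower worst-case measure is a member of `perturbSet Λ P` and minimises the expectation. -/
lemma worst_case_lower {S : Type*} [MeasurableSpace S] {P : Measure S} [IsProbabilityMeasure P]
    {v : S → ℝ} (hv_meas : Measurable v) {M : ℝ} (hv_bdd : ∀ x, |v x| ≤ M)
    {Λ : ℝ} (hΛ : 1 < Λ) {β : ℝ} (hP : P {x | v x ≤ β} = ENNReal.ofReal (Λ + 1)⁻¹) :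
    (P.withDensity fun x => ENNReal.ofReal (if v x ≤ β then Λ else Λ⁻¹)) ∈ perturbSet Λ P ∧
      ∀ U ∈ perturbSet Λ P,
        ∫ x, v x ∂(P.withDensity fun x => ENNReal.ofReal (if v x ≤ β then Λ else Λ⁻¹)) ≤
          ∫ x, v x ∂U := by
  have hset : MeasurableSet {x | v x ≤ β} := measurableSet_le hv_meas measurable_const
  have hmeas : Measurable fun x => ENNReal.ofReal (if v x ≤ β then Λ else Λ⁻¹) :=
    (Measurable.ite hset measurable_const measurable_const).ennreal_ofReal
  have hdens := Measure.rnDeriv_withDensity P hmeas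
  have hinv : Λ⁻¹ ≤ Λ := by linarith [inv_lt_one_of_one_lt₀ hΛ]
  have hmem : (P.withDensity fun x => ENNReal.ofReal (if v x ≤ β then Λ else Λ⁻¹)) ∈
      perturbSet Λ P := by
    refine ⟨isProbabilityMeasure_withDensity_ite hset hΛ hP,
      withDensity_absolutelyContinuous _ _, ?_⟩
    filter_upwards [hdens] with x hx
    rw [hx]
    split_ifs
    · exact ⟨ENNReal.ofReal_le_ofReal hinv, le_rfl⟩
    · exact ⟨le_rfl, ENNReal.ofReal_le_ofReal hinv⟩
  exact ⟨hmem, fun U hU => integral_le_of_mem_perturbSet_s3 hv_meas hv_bdd hΛ hmem hU hdens⟩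

/-- If `β⁻` is such that `P(v ≤ β⁻) = τ` (with `τ = 1/(Λ+1)`), then the measure `U⁻` with
density `Λ⁻¹ + (1−Λ⁻¹) τ⁻¹ 1[v ≤ β⁻]` w.r.t. `P` is a probability measure in `U_Λ(P)`
achieving the infimum of `∫ v dU` over `U_Λ(P)`; symmetrically for the supremum with
density `Λ⁻¹ + (1−Λ⁻¹) τ⁻¹ 1[v ≥ β⁺]` when `P(v ≥ β⁺) = τ`. -/
theorem worst_case_kernel_identification
    {S : Type*} [MeasurableSpace S] (P : Measure S) [IsProbabilityMeasure P]
    (v : S → ℝ) (hv_meas : Measurable v) (M : ℝ) (hv_bdd : ∀ x, |v x| ≤ M)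
    (Λ : ℝ) (hΛ : 1 < Λ) (τ : ℝ) (hτ : τ = (Λ + 1)⁻¹) (βm βp : ℝ) :
    (P {x | v x ≤ βm} = ENNReal.ofReal τ →
      (IsProbabilityMeasure
          (P.withDensity fun s' =>
            ENNReal.ofReal (Λ⁻¹ + (1 - Λ⁻¹) * τ⁻¹ * (if v s' ≤ βm then 1 else 0))) ∧
        (P.withDensity fun s' =>
            ENNReal.ofReal (Λ⁻¹ + (1 - Λ⁻¹) * τ⁻¹ * (if v s' ≤ βm then 1 else 0))) ∈
          perturbSet Λ P ∧
        ∫ x, v x ∂(P.withDensity fun s' =>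
            ENNReal.ofReal (Λ⁻¹ + (1 - Λ⁻¹) * τ⁻¹ * (if v s' ≤ βm then 1 else 0))) =
          sInf ((fun U : Measure S => ∫ x, v x ∂U) '' perturbSet Λ P))) ∧
    (P {x | βp ≤ v x} = ENNReal.ofReal τ →
      (IsProbabilityMeasure
          (P.withDensity fun s' =>
            ENNReal.ofReal (Λ⁻¹ + (1 - Λ⁻¹) * τ⁻¹ * (if βp ≤ v s' then 1 else 0))) ∧
        (P.withDensity fun s' =>
            ENNReal.ofReal (Λ⁻¹ + (1 - Λ⁻¹) * τ⁻¹ * (if βp ≤ v s' then 1 else 0))) ∈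
          perturbSet Λ P ∧
        ∫ x, v x ∂(P.withDensity fun s' =>
            ENNReal.ofReal (Λ⁻¹ + (1 - Λ⁻¹) * τ⁻¹ * (if βp ≤ v s' then 1 else 0))) =
          sSup ((fun U : Measure S => ∫ x, v x ∂U) '' perturbSet Λ P))) := by
  simp only [tilted_density_eq hΛ hτ]
  subst hτ
  refine ⟨fun hP => ?_, fun hP => ?_⟩
  · obtain ⟨hmem, hle⟩ := worst_case_lower hv_meas hv_bdd hΛ hP
    refine ⟨hmem.1, hmem, Eq.symm (IsLeast.csInf_eq ⟨⟨_, hmem, rfl⟩, ?_⟩)⟩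
    rintro _ ⟨U, hU, rfl⟩
    exact hle U hU
  · obtain ⟨hmem, hle⟩ := worst_case_lower (P := P) (v := fun x => -v x) (β := -βp) hv_meas.neg
      (fun x => (abs_neg (v x)).trans_le (hv_bdd x)) hΛ (by simpa only [neg_le_neg_iff] using hP)
    simp only [neg_le_neg_iff, integral_neg] at hmem hle
    refine ⟨hmem.1, hmem, Eq.symm (IsGreatest.csSup_eq ⟨⟨_, hmem, rfl⟩, ?_⟩)⟩
    rintro _ ⟨U, hU, rfl⟩
    exact hle U hU
end

section
/- In the MDP setup, for every bounded measurable f : S×A → ℝ: ∫ V^π_P(s) d₁(ds) − ∫∫ f(s,a) π(da|s) d₁(ds) = (1−γ)⁻¹ · ∫ ( T^π_P f(s,a) − f(s,a) ) d^{π,∞}_{d₁,P}(ds,da). -/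
open MeasureTheory ProbabilityTheory

/-- One step of the state-action chain: from `(s,a)`, sample `s' ~ P(·|s,a)` and
`a' ~ π(·|s')`, returning `(s',a')`. -/
noncomputable def stepKernel {S A : Type*} [MeasurableSpace S] [MeasurableSpace A]
    (P : Kernel (S × A) S) (π : Kernel S A) : Kernel (S × A) (S × A) :=
  (Kernel.id ×ₖ π) ∘ₖ P

/-- `t`-fold iterate of a kernel. -/
noncomputable def iterKernel {Z : Type*} [MeasurableSpace Z] (K : Kernel Z Z) :
    ℕ → Kernel Z Z
  | 0 => Kernel.id
  | n + 1 => K ∘ₖ iterKernel K n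

/-- Q-function: `Q^π_P(s,a) = Σ_t γ^t E[r(s_t,a_t)]` for the chain started at `(s,a)`. -/
noncomputable def Qfun {S A : Type*} [MeasurableSpace S] [MeasurableSpace A]
    (P : Kernel (S × A) S) (π : Kernel S A) (r : S × A → ℝ) (γ : ℝ) (sa : S × A) : ℝ :=
  ∑' t : ℕ, γ ^ t * ∫ z, r z ∂(iterKernel (stepKernel P π) t sa)

/-- Value function `V^π_P(s) = ∫ Q^π_P(s,a) π(da|s)`. -/
noncomputable def Vfun {S A : Type*} [MeasurableSpace S] [MeasurableSpace A]
    (P : Kernel (S × A) S) (π : Kernel S A) (r : S × A → ℝ) (γ : ℝ) (s : S) : ℝ :=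
  ∫ a, Qfun P π r γ (s, a) ∂(π s)

/-- Bellman operator `T^π_P f(s,a) = r(s,a) + γ ∫∫ f(s',a') π(da'|s') P(ds'|s,a)`. -/
noncomputable def bellman {S A : Type*} [MeasurableSpace S] [MeasurableSpace A]
    (P : Kernel (S × A) S) (π : Kernel S A) (r : S × A → ℝ) (γ : ℝ)
    (f : S × A → ℝ) (sa : S × A) : ℝ :=
  r sa + γ * ∫ z, f z ∂(stepKernel P π sa)

/-- `visit d1 P π h` is the law `d^{π,h+1}_{d₁,P}` of `(s_{h+1}, a_{h+1})`. -/
noncomputable def visit {S A : Type*} [MeasurableSpace S] [MeasurableSpace A]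
    (d1 : Measure S) (P : Kernel (S × A) S) (π : Kernel S A) : ℕ → Measure (S × A)
  | 0 => d1.bind (Kernel.id ×ₖ π)
  | n + 1 => (visit d1 P π n).bind (stepKernel P π)

/-- Discounted visitation distribution `d^{π,∞}_{d₁,P} = (1−γ) Σ_{h≥1} γ^{h−1} d^{π,h}`. -/
noncomputable def dvisit {S A : Type*} [MeasurableSpace S] [MeasurableSpace A]
    (γ : ℝ) (d1 : Measure S) (P : Kernel (S × A) S) (π : Kernel S A) : Measure (S × A) :=
  Measure.sum fun h => ENNReal.ofReal ((1 - γ) * γ ^ h) • visit d1 P π h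

section Helpers

variable {S A X Y Z : Type*} [MeasurableSpace S] [MeasurableSpace A]
  [MeasurableSpace X] [MeasurableSpace Y] [MeasurableSpace Z]

instance isMarkovKernel_stepKernel (P : Kernel (S × A) S) [IsMarkovKernel P]
    (π : Kernel S A) [IsMarkovKernel π] : IsMarkovKernel (stepKernel P π) := by
  unfold stepKernel; infer_instance

instance isMarkovKernel_iterKernel (K : Kernel Z Z) [IsMarkovKernel K] (n : ℕ) :
    IsMarkovKernel (iterKernel K n) := by
  induction n with
  | zero => unfold iterKernel; infer_instance
  | succ n ih => unfold iterKernel; infer_instance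

instance isProbabilityMeasure_visit (d1 : Measure S) [IsProbabilityMeasure d1]
    (P : Kernel (S × A) S) [IsMarkovKernel P] (π : Kernel S A) [IsMarkovKernel π] (n : ℕ) :
    IsProbabilityMeasure (visit d1 P π n) := by
  induction n with
  | zero => unfold visit; infer_instance
  | succ n ih => unfold visit; infer_instance

theorem visit_eq_bind_iterKernel (d1 : Measure S) (P : Kernel (S × A) S) (π : Kernel S A)
    (n : ℕ) :
    visit d1 P π n = (visit d1 P π 0).bind (iterKernel (stepKernel P π) n) := by
  induction n with
  | zero => exact Measure.id_comp.symm
  | succ n ih =>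
    rw [iterKernel, ← Measure.comp_assoc, ← ih]
    rfl

theorem integrable_of_measurable_of_abs_le (μ : Measure Z) [IsFiniteMeasure μ] {g : Z → ℝ}
    (hg : Measurable g) {C : ℝ} (hC : ∀ z, |g z| ≤ C) : Integrable g μ :=
  Integrable.of_bound hg.aestronglyMeasurable C (ae_of_all _ hC)

theorem abs_integral_le_of_abs_le (μ : Measure Z) [IsProbabilityMeasure μ] {g : Z → ℝ} {C : ℝ}
    (hC : ∀ z, |g z| ≤ C) : |∫ z, g z ∂μ| ≤ C := by
  simpa using norm_integral_le_of_norm_le_const (μ := μ) (C := C) (f := g) (ae_of_all μ hC)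

theorem integral_bind_kernel (μ : Measure X) (K : Kernel X Y) {g : Y → ℝ}
    (hg : Integrable g (μ.bind K)) :
    ∫ y, g y ∂(μ.bind K) = ∫ x, ∫ y, g y ∂(K x) ∂μ := by
  rw [Measure.comp_eq_comp_const_apply] at hg ⊢
  rw [Kernel.integral_comp hg, Kernel.const_apply]

theorem integral_visit_zero (d1 : Measure S) [IsProbabilityMeasure d1]
    (P : Kernel (S × A) S) (π : Kernel S A) [IsMarkovKernel π] {g : S × A → ℝ}
    (hg : Integrable g (visit d1 P π 0)) :
    ∫ z, g z ∂(visit d1 P π 0) = ∫ s, ∫ a, g (s, a) ∂(π s) ∂d1 := by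
  have h : visit d1 P π 0 = d1 ⊗ₘ π := (Measure.compProd_eq_comp_prod d1 π).symm
  rw [h] at hg ⊢
  exact Measure.integral_compProd hg

theorem summable_pow_mul_of_abs_le {γ : ℝ} (hγ : γ ∈ Set.Ico (0 : ℝ) 1) {u : ℕ → ℝ} {C : ℝ}
    (hu : ∀ n, |u n| ≤ C) : Summable fun n => γ ^ n * u n := by
  refine Summable.of_norm_bounded ((summable_geometric_of_lt_one hγ.1 hγ.2).mul_right C)
    fun n => ?_
  rw [Real.norm_eq_abs, abs_mul, abs_of_nonneg (pow_nonneg hγ.1 n)]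
  exact mul_le_mul_of_nonneg_left (hu n) (pow_nonneg hγ.1 n)

theorem hasSum_pow_mul_discounted_diff {γ : ℝ} (hγ : γ ∈ Set.Ico (0 : ℝ) 1) {u : ℕ → ℝ} {C : ℝ}
    (hu : ∀ n, |u n| ≤ C) : HasSum (fun n => γ ^ n * (γ * u (n + 1) - u n)) (-u 0) := by
  have hs := summable_pow_mul_of_abs_le hγ hu
  have h0 := hs.hasSum
  have h1 := (hasSum_nat_add_iff' (f := fun n => γ ^ n * u n) 1).mpr h0
  have hterm : ∀ n, γ ^ n * (γ * u (n + 1) - u n) = γ ^ (n + 1) * u (n + 1) - γ ^ n * u n :=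
    fun n => by ring
  simpa [hterm] using h1.sub h0

/-- The Q-function is integrable, and its integral over the initial state-action law
is the discounted sum of the expected rewards. -/
theorem integrable_Qfun_and_hasSum (P : Kernel (S × A) S) [IsMarkovKernel P]
    (π : Kernel S A) [IsMarkovKernel π] {r : S × A → ℝ} (hr : Measurable r) {C : ℝ}
    (hC : ∀ z, |r z| ≤ C) {γ : ℝ} (hγ : γ ∈ Set.Ico (0 : ℝ) 1)
    (d1 : Measure S) [IsProbabilityMeasure d1] :
    Integrable (Qfun P π r γ) (visit d1 P π 0) ∧
      HasSum (fun t => γ ^ t * ∫ z, r z ∂(visit d1 P π t))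
        (∫ z, Qfun P π r γ z ∂(visit d1 P π 0)) := by
  set F : ℕ → S × A → ℝ := fun t x => ∫ z, r z ∂(iterKernel (stepKernel P π) t x)
  have hF_meas : ∀ t, Measurable (F t) := fun t =>
    (hr.stronglyMeasurable.integral_kernel (κ := iterKernel (stepKernel P π) t)).measurable
  have hF_le : ∀ t x, |F t x| ≤ C := fun t x => abs_integral_le_of_abs_le _ hC
  have hF_sum : ∀ x, Summable fun t => γ ^ t * F t x := fun x =>
    summable_pow_mul_of_abs_le hγ fun t => hF_le t x
  have hQ_meas : Measurable (Qfun P π r γ) := by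
    refine measurable_of_tendsto_metrizable
      (f := fun n x => ∑ t ∈ Finset.range n, γ ^ t * F t x) (fun n => ?_) ?_
    · exact Finset.measurable_fun_sum _ fun t _ => (hF_meas t).const_mul _
    · exact tendsto_pi_nhds.mpr fun x => (hF_sum x).hasSum.tendsto_sum_nat
  have hterm_le : ∀ t x, |γ ^ t * F t x| ≤ γ ^ t * C := fun t x => by
    rw [abs_mul, abs_of_nonneg (pow_nonneg hγ.1 t)]
    exact mul_le_mul_of_nonneg_left (hF_le t x) (pow_nonneg hγ.1 t)
  have hgeom : Summable fun t => γ ^ t * C :=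
    (summable_geometric_of_lt_one hγ.1 hγ.2).mul_right C
  refine ⟨integrable_of_measurable_of_abs_le _ hQ_meas (C := ∑' t, γ ^ t * C) fun x =>
    tsum_of_norm_bounded (f := fun t => γ ^ t * F t x) hgeom.hasSum
      fun t => hterm_le t x, ?_⟩
  have hsum := hasSum_integral_of_summable_integral_norm (μ := visit d1 P π 0)
    (F := fun t x => γ ^ t * F t x)
    (fun t => integrable_of_measurable_of_abs_le _ ((hF_meas t).const_mul _) (hterm_le t))
    (Summable.of_norm_bounded hgeom fun t =>
      abs_integral_le_of_abs_le _ fun x => by simpa using! hterm_le t x)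
  refine hsum.congr_fun fun t => ?_
  rw [integral_const_mul, visit_eq_bind_iterKernel, integral_bind_kernel]
  exact integrable_of_measurable_of_abs_le _ hr hC

instance isFiniteMeasure_dvisit {γ : ℝ} [hγ : Fact (γ ∈ Set.Ico (0 : ℝ) 1)] (d1 : Measure S)
    [IsProbabilityMeasure d1] (P : Kernel (S × A) S) [IsMarkovKernel P] (π : Kernel S A)
    [IsMarkovKernel π] : IsFiniteMeasure (dvisit γ d1 P π) := by
  obtain ⟨h0, h1⟩ := hγ.out
  refine ⟨?_⟩
  have hs : Summable fun n => (1 - γ) * γ ^ n := (summable_geometric_of_lt_one h0 h1).mul_left _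
  simpa [dvisit, Measure.sum_apply] using hs.tsum_ofReal_lt_top

theorem hasSum_integral_dvisit {γ : ℝ} (hγ : γ ∈ Set.Ico (0 : ℝ) 1) (d1 : Measure S)
    [IsProbabilityMeasure d1] (P : Kernel (S × A) S) [IsMarkovKernel P] (π : Kernel S A)
    [IsMarkovKernel π] {g : S × A → ℝ} (hg : Measurable g) {C : ℝ} (hC : ∀ z, |g z| ≤ C) :
    HasSum (fun n => γ ^ n * ∫ z, g z ∂(visit d1 P π n))
      ((1 - γ)⁻¹ * ∫ z, g z ∂(dvisit γ d1 P π)) := by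
  have : Fact (γ ∈ Set.Ico (0 : ℝ) 1) := ⟨hγ⟩
  have hpos : 0 < 1 - γ := sub_pos.mpr hγ.2
  refine ((hasSum_integral_measure (integrable_of_measurable_of_abs_le
    (dvisit γ d1 P π) hg hC)).mul_left (1 - γ)⁻¹).congr_fun fun n => ?_
  rw [integral_smul_measure, ENNReal.toReal_ofReal (mul_nonneg hpos.le (pow_nonneg hγ.1 n)),
    smul_eq_mul, mul_assoc, inv_mul_cancel_left₀ hpos.ne']

end Helpers

/-- Performance difference: for every bounded measurable `f : S×A → ℝ`,
`∫ V^π_P d₁ − ∫∫ f dπ dd₁ = (1−γ)⁻¹ ∫ (T^π_P f − f) d d^{π,∞}_{d₁,P}`. -/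
theorem performance_difference
    {S A : Type*} [MeasurableSpace S] [MeasurableSpace A]
    (P : Kernel (S × A) S) [IsMarkovKernel P] (π : Kernel S A) [IsMarkovKernel π]
    (r : S × A → ℝ) (hr_meas : Measurable r) (hr_bdd : ∀ z, r z ∈ Set.Icc (0 : ℝ) 1)
    (γ : ℝ) (hγ : γ ∈ Set.Ico (0 : ℝ) 1)
    (d1 : Measure S) [IsProbabilityMeasure d1]
    (f : S × A → ℝ) (hf_meas : Measurable f) (M : ℝ) (hf_bdd : ∀ z, |f z| ≤ M) :
    (∫ s, Vfun P π r γ s ∂d1) - (∫ s, ∫ a, f (s, a) ∂(π s) ∂d1) =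
      (1 - γ)⁻¹ * ∫ z, bellman P π r γ f z - f z ∂(dvisit γ d1 P π) := by
  have hr_abs : ∀ z, |r z| ≤ 1 := fun z => abs_le.mpr
    ⟨by linarith [(hr_bdd z).1], (hr_bdd z).2⟩
  have hf_step_meas : Measurable fun x => ∫ z, f z ∂(stepKernel P π x) :=
    (hf_meas.stronglyMeasurable.integral_kernel (κ := stepKernel P π)).measurable
  have hf_step_le : ∀ x, |∫ z, f z ∂(stepKernel P π x)| ≤ M := fun x =>
    abs_integral_le_of_abs_le _ hf_bdd
  have hf_int : ∀ n, Integrable f (visit d1 P π n) := fun n =>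
    integrable_of_measurable_of_abs_le _ hf_meas hf_bdd
  have hT_meas : Measurable fun z => bellman P π r γ f z - f z :=
    (hr_meas.add (hf_step_meas.const_mul γ)).sub hf_meas
  have hT_le : ∀ z, |bellman P π r γ f z - f z| ≤ 1 + γ * M + M := fun z => by
    refine (abs_sub _ _).trans (add_le_add ((abs_add_le _ _).trans
      (add_le_add (hr_abs z) ?_)) (hf_bdd z))
    rw [abs_mul, abs_of_nonneg hγ.1]
    exact mul_le_mul_of_nonneg_left (hf_step_le z) hγ.1
  have hT_visit : ∀ n, ∫ z, bellman P π r γ f z - f z ∂(visit d1 P π n) =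
      ∫ z, r z ∂(visit d1 P π n) +
        (γ * ∫ z, f z ∂(visit d1 P π (n + 1)) - ∫ z, f z ∂(visit d1 P π n)) := fun n => by
    have hr_int := integrable_of_measurable_of_abs_le (visit d1 P π n) hr_meas hr_abs
    have hstep_int := (integrable_of_measurable_of_abs_le (visit d1 P π n) hf_step_meas
      hf_step_le).const_mul γ
    have hnext : ∫ z, f z ∂(visit d1 P π (n + 1)) =
        ∫ x, ∫ z, f z ∂(stepKernel P π x) ∂(visit d1 P π n) :=
      integral_bind_kernel _ _ (hf_int (n + 1))
    unfold bellman
    rw [integral_sub (hr_int.fun_add hstep_int) (hf_int n), integral_add hr_int hstep_int,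
      integral_const_mul, hnext, add_sub_assoc]
  obtain ⟨hQ_int, hQ_sum⟩ := integrable_Qfun_and_hasSum P π hr_meas hr_abs hγ d1
  have htel := hasSum_pow_mul_discounted_diff hγ
    (u := fun n => ∫ z, f z ∂(visit d1 P π n)) fun n => abs_integral_le_of_abs_le _ hf_bdd
  have hrhs := hasSum_integral_dvisit hγ d1 P π hT_meas hT_le
  simp only [hT_visit, mul_add] at hrhs
  rw [hrhs.unique (hQ_sum.add htel), ← sub_eq_add_neg,
    integral_visit_zero d1 P π hQ_int, integral_visit_zero d1 P π (hf_int 0)]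
  rfl
end

section
/- In the MDP setup, let f₀, f₁, …, f_K : S×A → [0, (1−γ)⁻¹] be measurable functions with f₀ ≡ 0. Then ‖ f_K − T^π_P f_K ‖_{L²(d^{π,∞}_{d₁,P})} ≤ (4/(1−γ)) · max_{1 ≤ k ≤ K} ‖ f_k − T^π_P f_{k−1} ‖_{L²(d^{π,∞}_{d₁,P})} + γ^{K/2}. -/
open MeasureTheory ProbabilityTheory

/-- `L²(μ)` norm. -/
noncomputable def norm2 {Z : Type*} [MeasurableSpace Z] (μ : Measure Z) (g : Z → ℝ) : ℝ :=
  Real.sqrt (∫ z, (g z) ^ 2 ∂μ)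

/-- A measurable function that is bounded in absolute value. -/
structure BoundedMeasurable {Z : Type*} [MeasurableSpace Z] (g : Z → ℝ) : Prop where
  measurable : Measurable g
  bounded : ∃ C, ∀ z, |g z| ≤ C

namespace BoundedMeasurable

variable {Z : Type*} [MeasurableSpace Z] {g h : Z → ℝ}

theorem of_mem_Icc {c : ℝ} (hg : Measurable g) (hb : ∀ z, g z ∈ Set.Icc 0 c) :
    BoundedMeasurable g :=
  ⟨hg, c, fun z => by rw [abs_of_nonneg (hb z).1]; exact (hb z).2⟩

theorem add (hg : BoundedMeasurable g) (hh : BoundedMeasurable h) :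
    BoundedMeasurable fun z => g z + h z := by
  obtain ⟨hgm, C, hC⟩ := hg
  obtain ⟨hhm, D, hD⟩ := hh
  exact ⟨hgm.add hhm, C + D, fun z => (abs_add_le _ _).trans (add_le_add (hC z) (hD z))⟩

theorem const_mul (hg : BoundedMeasurable g) (c : ℝ) : BoundedMeasurable fun z => c * g z := by
  obtain ⟨hgm, C, hC⟩ := hg
  refine ⟨hgm.const_mul c, |c| * C, fun z => ?_⟩
  rw [abs_mul]
  exact mul_le_mul_of_nonneg_left (hC z) (abs_nonneg c)

theorem sub (hg : BoundedMeasurable g) (hh : BoundedMeasurable h) :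
    BoundedMeasurable fun z => g z - h z := by
  simpa [sub_eq_add_neg] using hg.add (hh.const_mul (-1))

theorem memLp (hg : BoundedMeasurable g) (p : ENNReal) (μ : Measure Z) [IsFiniteMeasure μ] :
    MemLp g p μ := by
  obtain ⟨hgm, C, hC⟩ := hg
  exact MemLp.of_bound hgm.aestronglyMeasurable C (ae_of_all _ hC)

theorem integrable (hg : BoundedMeasurable g) (μ : Measure Z) [IsFiniteMeasure μ] :
    Integrable g μ :=
  memLp_one_iff_integrable.1 (hg.memLp 1 μ)

theorem integral_kernel (hg : BoundedMeasurable g) (κ : Kernel Z Z) [IsMarkovKernel κ] :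
    BoundedMeasurable fun z => ∫ y, g y ∂(κ z) := by
  obtain ⟨hgm, C, hC⟩ := hg
  refine ⟨hgm.stronglyMeasurable.integral_kernel.measurable, C, fun z => ?_⟩
  simpa using norm_integral_le_of_norm_le_const (μ := κ z) (f := g) (C := C) (ae_of_all _ hC)

end BoundedMeasurable

theorem sq_integral_le_integral_sq {Z : Type*} [MeasurableSpace Z] {μ : Measure Z}
    [IsProbabilityMeasure μ] {g : Z → ℝ} (hg : MemLp g 2 μ) :
    (∫ z, g z ∂μ) ^ 2 ≤ ∫ z, g z ^ 2 ∂μ := by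
  have h := variance_nonneg g μ
  rw [variance_eq_sub hg] at h
  simpa using h

theorem norm2_eq_lpNorm {Z : Type*} [MeasurableSpace Z] {μ : Measure Z} {g : Z → ℝ}
    (hg : AEStronglyMeasurable g μ) : norm2 μ g = lpNorm g 2 μ := by
  rw [lpNorm_eq_integral_norm_rpow_toReal (by simp) (by simp) hg, norm2, Real.sqrt_eq_rpow]
  simp

theorem norm2_nonneg {Z : Type*} [MeasurableSpace Z] (μ : Measure Z) (g : Z → ℝ) :
    0 ≤ norm2 μ g :=
  Real.sqrt_nonneg _

theorem norm2_sub_add_le {Z : Type*} [MeasurableSpace Z] {μ : Measure Z} {a b c : Z → ℝ}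
    (ha : MemLp a 2 μ) (hb : MemLp b 2 μ) (hc : MemLp c 2 μ) :
    norm2 μ (fun z => a z - b z + c z) ≤ norm2 μ a + norm2 μ b + norm2 μ c := by
  rw [norm2_eq_lpNorm ha.1, norm2_eq_lpNorm hb.1, norm2_eq_lpNorm hc.1]
  calc norm2 μ ((a - b) + c) = lpNorm ((a - b) + c) 2 μ :=
        norm2_eq_lpNorm ((ha.1.sub hb.1).add hc.1)
    _ ≤ lpNorm (a - b) 2 μ + lpNorm c 2 μ :=
        lpNorm_add_le (ha.sub hb) (by norm_num)
    _ ≤ _ := by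
        gcongr
        exact lpNorm_sub_le ha (by norm_num)

/-- If `γ • (κ ∘ₘ μ) ≤ μ`, then `g ↦ γ ∫ g dκ` contracts the `L²(μ)` norm by `√γ`. -/
theorem norm2_mul_integral_kernel_le {Z : Type*} [MeasurableSpace Z] {μ : Measure Z}
    [IsProbabilityMeasure μ] (κ : Kernel Z Z) [IsMarkovKernel κ] {γ : ℝ} (hγ : 0 ≤ γ)
    (hμ : ENNReal.ofReal γ • μ.bind κ ≤ μ) {g : Z → ℝ} (hg : BoundedMeasurable g) :
    norm2 μ (fun z => γ * ∫ y, g y ∂(κ z)) ≤ √γ * norm2 μ g := by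
  have hg2 : BoundedMeasurable fun z => g z ^ 2 := by
    obtain ⟨hgm, C, hC⟩ := hg
    refine ⟨hgm.pow_const 2, C ^ 2, fun z => ?_⟩
    rw [abs_pow]
    exact pow_le_pow_left₀ (abs_nonneg _) (hC z) 2
  rw [norm2, norm2, ← Real.sqrt_mul hγ]
  apply Real.sqrt_le_sqrt
  calc ∫ z, (γ * ∫ y, g y ∂(κ z)) ^ 2 ∂μ
      = γ ^ 2 * ∫ z, (∫ y, g y ∂(κ z)) ^ 2 ∂μ := by
        simp_rw [mul_pow]
        exact integral_const_mul _ _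
    _ ≤ γ ^ 2 * ∫ z, ∫ y, g y ^ 2 ∂(κ z) ∂μ := by
        gcongr
        · exact ((hg.integral_kernel κ).memLp 2 μ).integrable_sq
        · exact (hg2.integral_kernel κ).integrable μ
        · exact fun z => sq_integral_le_integral_sq (hg.memLp 2 _)
    _ = γ * ∫ z, g z ^ 2 ∂(ENNReal.ofReal γ • μ.bind κ) := by
        have hbind : ∫ z, g z ^ 2 ∂(μ.bind κ) = ∫ z, ∫ y, g y ^ 2 ∂(κ z) ∂μ := by
          rw [Measure.comp_eq_comp_const_apply, Kernel.integral_comp (hg2.integrable _),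
            Kernel.const_apply]
        rw [integral_smul_measure, hbind, ENNReal.toReal_ofReal hγ, smul_eq_mul]
        ring
    _ ≤ γ * ∫ z, g z ^ 2 ∂μ := by
        gcongr
        · exact ae_of_all _ fun z => sq_nonneg _
        · exact hg2.integrable μ

theorem smul_bind_dvisit_le {S A : Type*} [MeasurableSpace S] [MeasurableSpace A]
    (P : Kernel (S × A) S) (π : Kernel S A) (d1 : Measure S) {γ : ℝ} (hγ : γ ∈ Set.Ico (0 : ℝ) 1) :
    ENNReal.ofReal γ • (dvisit γ d1 P π).bind (stepKernel P π) ≤ dvisit γ d1 P π := by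
  have hw (n : ℕ) : ENNReal.ofReal γ * ENNReal.ofReal ((1 - γ) * γ ^ n) =
      ENNReal.ofReal ((1 - γ) * γ ^ (n + 1)) := by
    rw [← ENNReal.ofReal_mul hγ.1]
    ring_nf
  refine Measure.le_iff.2 fun s hs => ?_
  rw [dvisit, Measure.bind_sum _ _ (Kernel.aemeasurable _), Measure.smul_apply,
    Measure.sum_apply _ hs, Measure.sum_apply _ hs, smul_eq_mul, ← ENNReal.tsum_mul_left]
  simp only [Measure.bind_smul, Measure.smul_apply, smul_eq_mul, ← mul_assoc, hw]
  exact ENNReal.tsum_comp_le_tsum_of_injective (add_left_injective 1)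
    fun n => ENNReal.ofReal ((1 - γ) * γ ^ n) * visit d1 P π n s

section Visitation

variable {S A : Type*} [MeasurableSpace S] [MeasurableSpace A]
  (P : Kernel (S × A) S) [IsMarkovKernel P] (π : Kernel S A) [IsMarkovKernel π]
  (d1 : Measure S) [IsProbabilityMeasure d1]

instance : IsMarkovKernel (stepKernel P π) := by
  unfold stepKernel
  infer_instance

instance (n : ℕ) : IsProbabilityMeasure (visit d1 P π n) := by
  induction n with
  | zero => unfold visit; infer_instance
  | succ n ih => unfold visit; infer_instance

theorem isProbabilityMeasure_dvisit {γ : ℝ} (hγ : γ ∈ Set.Ico (0 : ℝ) 1) :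
    IsProbabilityMeasure (dvisit γ d1 P π) := by
  have hpos : 0 < 1 - γ := sub_pos.2 hγ.2
  have hs := (hasSum_geometric_of_lt_one hγ.1 hγ.2).mul_left (1 - γ)
  rw [mul_inv_cancel₀ hpos.ne'] at hs
  refine ⟨?_⟩
  rw [dvisit, Measure.sum_apply _ MeasurableSet.univ]
  simp only [Measure.smul_apply, measure_univ, smul_eq_mul, mul_one]
  rw [← ENNReal.ofReal_tsum_of_nonneg (fun n => mul_nonneg hpos.le (pow_nonneg hγ.1 n))
    hs.summable, hs.tsum_eq, ENNReal.ofReal_one]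

variable {P π} in
theorem BoundedMeasurable.bellman {r : S × A → ℝ} (hr : BoundedMeasurable r) (γ : ℝ)
    {g : S × A → ℝ} (hg : BoundedMeasurable g) : BoundedMeasurable (bellman P π r γ g) :=
  hr.add ((hg.integral_kernel _).const_mul γ)

end Visitation

/-- The Bellman residual of `g` in terms of `e = g - T f` and the Bellman residual of `f`. -/
theorem sub_bellman_eq {S A : Type*} [MeasurableSpace S] [MeasurableSpace A]
    (P : Kernel (S × A) S) [IsMarkovKernel P] (π : Kernel S A) [IsMarkovKernel π]
    {r f g : S × A → ℝ} (γ : ℝ) (hr : BoundedMeasurable r) (hf : BoundedMeasurable f)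
    (hg : BoundedMeasurable g) (z : S × A) :
    g z - bellman P π r γ g z =
      (g z - bellman P π r γ f z) -
        γ * ∫ y, (g y - bellman P π r γ f y) ∂(stepKernel P π z) +
        γ * ∫ y, (f y - bellman P π r γ f y) ∂(stepKernel P π z) := by
  have hT := (hr.bellman (P := P) (π := π) γ hf).integrable (stepKernel P π z)
  rw [integral_sub (hg.integrable _) hT, integral_sub (hf.integrable _) hT]
  simp only [bellman]
  ring

theorem le_biSup_finset {ι : Type*} {s : Finset ι} {F : ι → ℝ} (hF : ∀ i, 0 ≤ F i) {k : ι}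
    (hk : k ∈ s) : F k ≤ ⨆ i ∈ s, F i := by
  have hbdd : BddAbove (Set.range fun i => ⨆ _ : i ∈ s, F i) := by
    refine ⟨∑ i ∈ s, F i, ?_⟩
    rintro _ ⟨i, rfl⟩
    exact Real.iSup_le (fun hi => Finset.single_le_sum (fun j _ => hF j) hi)
      (Finset.sum_nonneg fun j _ => hF j)
  exact le_ciSup_of_le hbdd k (ciSup_pos (f := fun _ => F k) hk).ge

theorem le_of_le_add_mul {s m x y c : ℝ} (hs0 : 0 ≤ s) (hs1 : s < 1) (hm : 0 ≤ m)
    (hy : y ≤ 4 / (1 - s ^ 2) * m + c) (hx : x ≤ m + s * m + s * y) :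
    x ≤ 4 / (1 - s ^ 2) * m + s * c := by
  have hpos : 0 < 1 - s ^ 2 := by nlinarith
  have hcoef : 1 + s + s * (4 / (1 - s ^ 2)) ≤ 4 / (1 - s ^ 2) := by
    rw [le_div_iff₀ hpos, add_mul, mul_assoc, div_mul_cancel₀ _ hpos.ne']
    have hs := sub_nonneg.2 hs1.le
    nlinarith [mul_nonneg hs hs, mul_nonneg hs0 hs, mul_nonneg hs0 (mul_nonneg hs0 hs)]
  nlinarith [mul_le_mul_of_nonneg_right hcoef hm, mul_le_mul_of_nonneg_left hy hs0]

/-- Unrolling lemma: for `f₀ ≡ 0` and `f₁,…,f_K` valued in `[0,(1−γ)⁻¹]`,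
`‖f_K − T^π_P f_K‖_{L²(d^{π,∞})} ≤ (4/(1−γ)) max_{1≤k≤K} ‖f_k − T^π_P f_{k−1}‖_{L²(d^{π,∞})}
 + γ^{K/2}`. -/
theorem fqe_unrolling
    {S A : Type*} [MeasurableSpace S] [MeasurableSpace A]
    (P : Kernel (S × A) S) [IsMarkovKernel P] (π : Kernel S A) [IsMarkovKernel π]
    (r : S × A → ℝ) (hr_meas : Measurable r) (hr_bdd : ∀ z, r z ∈ Set.Icc (0 : ℝ) 1)
    (γ : ℝ) (hγ : γ ∈ Set.Ico (0 : ℝ) 1)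
    (d1 : Measure S) [IsProbabilityMeasure d1]
    (K : ℕ) (f : ℕ → (S × A) → ℝ) (hf0 : ∀ z, f 0 z = 0)
    (hf_meas : ∀ k ≤ K, Measurable (f k))
    (hf_bdd : ∀ k ≤ K, ∀ z, f k z ∈ Set.Icc (0 : ℝ) (1 - γ)⁻¹) :
    norm2 (dvisit γ d1 P π) (fun z => f K z - bellman P π r γ (f K) z) ≤
      (4 / (1 - γ)) *
        (⨆ k ∈ Finset.Icc 1 K,
          norm2 (dvisit γ d1 P π) (fun z => f k z - bellman P π r γ (f (k - 1)) z)) +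
      γ ^ ((K : ℝ) / 2) := by
  have hs0 := Real.sqrt_nonneg γ
  have hs2 : √γ ^ 2 = γ := Real.sq_sqrt hγ.1
  have hs1 : √γ < 1 := by rw [Real.sqrt_lt' one_pos]; simpa using hγ.2
  have hμ := smul_bind_dvisit_le P π d1 hγ
  have : IsProbabilityMeasure (dvisit γ d1 P π) := isProbabilityMeasure_dvisit P π d1 hγ
  set μ := dvisit γ d1 P π
  have hr := BoundedMeasurable.of_mem_Icc hr_meas hr_bdd
  have hf (k : ℕ) (hk : k ≤ K) := BoundedMeasurable.of_mem_Icc (hf_meas k hk) (hf_bdd k hk)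
  set F : ℕ → ℝ := fun k => norm2 μ fun z => f k z - bellman P π r γ (f (k - 1)) z
  set M := ⨆ k ∈ Finset.Icc 1 K, F k
  have hFM (k : ℕ) (hk : k ∈ Finset.Icc 1 K) : F k ≤ M :=
    le_biSup_finset (F := F) (fun i => norm2_nonneg μ _) hk
  have hM : 0 ≤ M := Real.iSup_nonneg fun k => Real.iSup_nonneg fun _ => norm2_nonneg μ _
  have main (k : ℕ) (hk : k ≤ K) :
      norm2 μ (fun z => f k z - bellman P π r γ (f k) z) ≤ 4 / (1 - √γ ^ 2) * M + √γ ^ k := by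
    induction k with
    | zero =>
      have h1 : norm2 μ (fun z => f 0 z - bellman P π r γ (f 0) z) ≤ 1 := by
        rw [norm2, Real.sqrt_le_one]
        simp only [bellman, hf0, integral_zero, mul_zero, add_zero, zero_sub, neg_sq]
        calc ∫ z, r z ^ 2 ∂μ ≤ ∫ _, (1 : ℝ) ∂μ :=
              integral_mono (hr.memLp 2 μ).integrable_sq (integrable_const _)
                fun z => pow_le_one₀ (hr_bdd z).1 (hr_bdd z).2
          _ = 1 := by simp
      have h2 : 0 ≤ 4 / (1 - √γ ^ 2) * M :=
        mul_nonneg (div_nonneg (by norm_num) (by rw [hs2]; linarith [hγ.2])) hM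
      simpa using h1.trans (le_add_of_nonneg_left h2)
    | succ k ih =>
      have hk' : k ≤ K := Nat.le_of_succ_le hk
      have hT := hr.bellman (P := P) (π := π) γ (hf k hk')
      have he := (hf (k + 1) hk).sub hT
      have hg := (hf k hk').sub hT
      have hFk : norm2 μ (fun z => f (k + 1) z - bellman P π r γ (f k) z) ≤ M :=
        hFM (k + 1) (Finset.mem_Icc.2 ⟨Nat.le_add_left 1 k, hk⟩)
      rw [pow_succ' _ k]
      refine le_of_le_add_mul hs0 hs1 hM (ih hk') ?_
      simp_rw [sub_bellman_eq P π γ hr (hf k hk') (hf (k + 1) hk)]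
      refine (norm2_sub_add_le (he.memLp 2 μ)
        (((he.integral_kernel (stepKernel P π)).const_mul γ).memLp 2 μ)
        (((hg.integral_kernel (stepKernel P π)).const_mul γ).memLp 2 μ)).trans ?_
      have hPe := norm2_mul_integral_kernel_le (stepKernel P π) hγ.1 hμ he
      have hPg := norm2_mul_integral_kernel_le (stepKernel P π) hγ.1 hμ hg
      linarith [mul_le_mul_of_nonneg_left hFk hs0]
  have hpow : γ ^ ((K : ℝ) / 2) = √γ ^ K := by
    rw [Real.sqrt_eq_rpow, ← Real.rpow_mul_natCast hγ.1]
    ring_nf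
  rw [hpow]
  simpa only [hs2] using main K le_rfl
end

section
/- In the MDP-with-data setup, suppose the bounded measurable functions q⁻ : S×A → ℝ and β⁻ : S×A → ℝ satisfy, for ν-almost every (s,a): q⁻(s,a) = r(s,a) + γ (1−λ(s,a)) ∫ v⁻(s') P(ds'|s,a) + γ λ(s,a) CVaR⁻_{τ(s,a)}( v⁻ ; P(·|s,a) ), where v⁻(s) := ∫ q⁻(s,a) π(da|s), and that β⁻(s,a) attains the supremum in the definition of CVaR⁻_{τ(s,a)}( v⁻ ; P(·|s,a) ) for ν-almost every (s,a). Then for every bounded measurable w : S×A → ℝ: E_{ν,P}[ ψ(s,a,s'; w, q⁻, β⁻) ] = (1−γ) ∫ v⁻ dd₁. -/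
open MeasureTheory ProbabilityTheory

/-- `τ(s,a) := 1/(1+Λ(s,a))`. -/
noncomputable def tauOf {Z : Type*} (Λ : Z → ℝ) (z : Z) : ℝ := (1 + Λ z)⁻¹

/-- `λ(s,a) := 1 − Λ(s,a)⁻¹`. -/
noncomputable def lamOf {Z : Type*} (Λ : Z → ℝ) (z : Z) : ℝ := 1 - (Λ z)⁻¹

/-- `v(s) := ∫ q(s,a) π(da|s)`. -/
noncomputable def vOf {S A : Type*} [MeasurableSpace S] [MeasurableSpace A]
    (π : Kernel S A) (q : S × A → ℝ) (s : S) : ℝ :=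
  ∫ a, q (s, a) ∂(π s)

/-- `ρ(s,a,s'; v, β) = (1−λ) v(s') + λ (β(s,a) + τ⁻¹ min(v(s') − β(s,a), 0))`. -/
noncomputable def rho {S A : Type*} (Λ : S × A → ℝ) (v : S → ℝ) (β : S × A → ℝ)
    (sa : S × A) (s' : S) : ℝ :=
  (1 - lamOf Λ sa) * v s' +
    lamOf Λ sa * (β sa + (tauOf Λ sa)⁻¹ * min (v s' - β sa) 0)

/-- The (recentered) EIF integrand
`ψ(s,a,s'; w, q, β) = (1−γ) ∫ v dd₁ + w(s,a)(r(s,a) + γ ρ(s,a,s'; v, β) − q(s,a))`. -/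
noncomputable def psi {S A : Type*} [MeasurableSpace S] [MeasurableSpace A]
    (π : Kernel S A) (r : S × A → ℝ) (γ : ℝ) (d1 : Measure S) (Λ : S × A → ℝ)
    (w q β : S × A → ℝ) (sa : S × A) (s' : S) : ℝ :=
  (1 - γ) * (∫ s, vOf π q s ∂d1) +
    w sa * (r sa + γ * rho Λ (vOf π q) β sa s' - q sa)

theorem measurable_vOf {S A : Type*} [MeasurableSpace S] [MeasurableSpace A]
    (π : Kernel S A) [IsSFiniteKernel π] {q : S × A → ℝ} (hq : Measurable q) :
    Measurable (vOf π q) :=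
  hq.stronglyMeasurable.integral_kernel_prod_right'.measurable

theorem abs_vOf_le {S A : Type*} [MeasurableSpace S] [MeasurableSpace A]
    (π : Kernel S A) [IsMarkovKernel π] {q : S × A → ℝ} {M : ℝ} (hq : ∀ z, |q z| ≤ M) (s : S) :
    |vOf π q s| ≤ M := by
  simpa [vOf] using norm_integral_le_of_norm_le_const (μ := π s)
    (f := fun a => q (s, a)) (Filter.Eventually.of_forall fun a => hq (s, a))

theorem integral_rho {S A : Type*} [MeasurableSpace S] (μ : Measure S) [IsProbabilityMeasure μ]
    (Λ : S × A → ℝ) {v : S → ℝ} (hv : Integrable v μ) (β : S × A → ℝ) (sa : S × A) :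
    ∫ s', rho Λ v β sa s' ∂μ = (1 - lamOf Λ sa) * ∫ s', v s' ∂μ +
      lamOf Λ sa * (β sa + (tauOf Λ sa)⁻¹ * ∫ s', min (v s' - β sa) 0 ∂μ) := by
  have hmin : Integrable (fun s' => min (v s' - β sa) 0) μ :=
    (hv.sub (integrable_const _)).inf (integrable_const 0)
  have hτ := hmin.const_mul (tauOf Λ sa)⁻¹
  have hβτ : Integrable (fun s' => β sa + (tauOf Λ sa)⁻¹ * min (v s' - β sa) 0) μ :=
    (integrable_const _).add hτ
  simp only [rho]
  rw [integral_add (hv.const_mul _) (hβτ.const_mul _),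
    integral_const_mul, integral_const_mul, integral_add (integrable_const _) hτ,
    integral_const_mul]
  simp

theorem integrable_rho {S A : Type*} [MeasurableSpace S] (μ : Measure S) [IsFiniteMeasure μ]
    (Λ : S × A → ℝ) {v : S → ℝ} (hv : Integrable v μ) (β : S × A → ℝ) (sa : S × A) :
    Integrable (rho Λ v β sa) μ :=
  (hv.const_mul _).add (((integrable_const _).add
    (((hv.sub (integrable_const _)).inf (integrable_const 0)).const_mul _)).const_mul _)

theorem integral_psi {S A : Type*} [MeasurableSpace S] [MeasurableSpace A]
    (μ : Measure S) [IsProbabilityMeasure μ] (π : Kernel S A) (r : S × A → ℝ) (γ : ℝ)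
    (d1 : Measure S) (Λ w q β : S × A → ℝ) (hv : Integrable (vOf π q) μ) (sa : S × A) :
    ∫ s', psi π r γ d1 Λ w q β sa s' ∂μ = (1 - γ) * (∫ s, vOf π q s ∂d1) +
      w sa * (r sa + γ * (∫ s', rho Λ (vOf π q) β sa s' ∂μ) - q sa) := by
  have hρ := (integrable_rho μ Λ hv β sa).const_mul γ
  have hrρ : Integrable (fun s' => r sa + γ * rho Λ (vOf π q) β sa s') μ :=
    (integrable_const _).add hρ
  have hres : Integrable (fun s' => r sa + γ * rho Λ (vOf π q) β sa s' - q sa) μ :=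
    hrρ.sub (integrable_const _)
  simp only [psi]
  rw [integral_add (integrable_const _) (hres.const_mul _),
    integral_const_mul (w sa), integral_sub hrρ (integrable_const _),
    integral_add (integrable_const _) hρ, integral_const_mul γ]
  simp

/-- Sharpness with correct `Q⁻` and `β⁻`: if `q⁻` satisfies the (identified) robust Bellman
equation `ν`-a.e. and `β⁻` attains the supremum defining the CVaR `ν`-a.e., then
`E_{ν,P}[ψ(s,a,s'; w, q⁻, β⁻)] = (1−γ) ∫ v⁻ dd₁` for every bounded measurable `w`. -/
theorem sharpness_correct_q_beta
    {S A : Type*} [MeasurableSpace S] [MeasurableSpace A]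
    (P : Kernel (S × A) S) [IsMarkovKernel P] (π : Kernel S A) [IsMarkovKernel π]
    (r : S × A → ℝ) (hr_meas : Measurable r) (hr_bdd : ∀ z, r z ∈ Set.Icc (0 : ℝ) 1)
    (γ : ℝ) (hγ : γ ∈ Set.Ico (0 : ℝ) 1)
    (d1 : Measure S) [IsProbabilityMeasure d1]
    (ν : Measure (S × A)) [IsProbabilityMeasure ν]
    (Λ : S × A → ℝ) (hΛ_meas : Measurable Λ) (hΛ_lb : ∀ sa, 1 ≤ Λ sa)
    (MΛ : ℝ) (hΛ_ub : ∀ sa, Λ sa ≤ MΛ)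
    (qm βm : S × A → ℝ) (hq_meas : Measurable qm) (hβ_meas : Measurable βm)
    (Mq : ℝ) (hq_bdd : ∀ sa, |qm sa| ≤ Mq) (Mβ : ℝ) (hβ_bdd : ∀ sa, |βm sa| ≤ Mβ)
    (hq_bellman : ∀ᵐ sa ∂ν,
      qm sa = r sa + γ * (1 - lamOf Λ sa) * (∫ s', vOf π qm s' ∂(P sa)) +
        γ * lamOf Λ sa * cvarLower (tauOf Λ sa) (vOf π qm) (P sa))
    (hβ_attains : ∀ᵐ sa ∂ν,
      βm sa + (tauOf Λ sa)⁻¹ * (∫ s', min (vOf π qm s' - βm sa) 0 ∂(P sa)) =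
        cvarLower (tauOf Λ sa) (vOf π qm) (P sa))
    (w : S × A → ℝ) (hw_meas : Measurable w) (Mw : ℝ) (hw_bdd : ∀ sa, |w sa| ≤ Mw) :
    (∫ sa, ∫ s', psi π r γ d1 Λ w qm βm sa s' ∂(P sa) ∂ν) =
      (1 - γ) * ∫ s, vOf π qm s ∂d1 := by
  have hinner : ∀ᵐ sa ∂ν, ∫ s', psi π r γ d1 Λ w qm βm sa s' ∂(P sa) =
      (1 - γ) * ∫ s, vOf π qm s ∂d1 := by
    filter_upwards [hq_bellman, hβ_attains] with sa hq hβ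
    have hv : Integrable (vOf π qm) (P sa) :=
      Integrable.of_bound (measurable_vOf π hq_meas).aestronglyMeasurable Mq
        (Filter.Eventually.of_forall (abs_vOf_le π hq_bdd))
    rw [integral_psi (P sa) π r γ d1 Λ w qm βm hv, integral_rho (P sa) Λ hv, hβ]
    linear_combination (-w sa) * hq
  rw [integral_congr_ae hinner]
  simp
end
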